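/- Let A be a real symmetric positive definite n×n matrix (n ≥ 1). Let X : ℕ → (n×n real matrices) be a sequence such that X(0) is symmetric positive semidefinite, X(0)·A = A·X(0), trace(X(0)·A) > 0, and for each k ≥ 0 the following recurrence holds: with w_k = ⟨X(k)·A, I⟩, D_k = −(1/n)((w_k/n)·X(k)·A − I), α_k = |(n·⟨D_k·A, I⟩ − w_k·⟨X(k)·A, D_k·A⟩) / (⟨D_k·A, I⟩·⟨X(k)·A, D_k·A⟩ − w_k·‖D_k·A‖_F²)|, Z(k+1) = X(k) + α_k·D_k, and X(k+1) = s_k·√n·Z(k+1)/‖Z(k+1)·A‖_F, where s_k = 1 if trace(Z(k+1)·A) > 0 and s_k = −1 otherwise. Assume that for every k the denominator in the definition of α_k is nonzero and Z(k+1)·A ≠ 0. Then the sequence X(k) converges to A⁻¹ (in the space of n×n real matrices). -/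

import Mathlib

open Matrix Filter

/-- The Frobenius inner product of two real matrices: `⟪A, B⟫ = trace (Aᵀ * B)`. -/
noncomputable def finner {m n : ℕ} (A B : Matrix (Fin m) (Fin n) ℝ) : ℝ :=
  (Aᵀ * B).trace

/-- The Frobenius norm of a real matrix: `‖A‖_F = ⟪A, A⟫ ^ (1/2)`. -/
noncomputable def fnorm {m n : ℕ} (A : Matrix (Fin m) (Fin n) ℝ) : ℝ :=
  Real.sqrt (finner A A)

theorem mc_mono (n w p q r b : ℝ) (hn : 0 < n)
    (hcs : ∀ t : ℝ, (w + t * p) ^ 2 ≤ n * (n + 2 * t * q + t ^ 2 * r))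
    (hpos : ∀ t : ℝ, 0 ≤ t → t < b → 0 < (n * p - w * q) + t * (p * q - w * r))
    (hb : 0 < n + 2 * b * q + b ^ 2 * r) :
    StrictMonoOn (fun t : ℝ => (w + t * p) / Real.sqrt (n + 2 * t * q + t ^ 2 * r))
      (Set.Icc 0 b) := by
  have hN : ∀ t ∈ Set.Icc 0 b, 0 < n + 2 * t * q + t ^ 2 * r := by
    intro t ht
    rcases eq_or_lt_of_le ht.2 with h | h
    · rw [h]; exact hb
    · have h1 := hpos t ht.1 h
      have h2 := hcs t
      by_contra hc
      push Not at hc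
      have h3 : (w + t * p) ^ 2 ≤ 0 := by nlinarith
      have h4 : w + t * p = 0 := by nlinarith [sq_nonneg (w + t * p), pow_eq_zero_iff (two_ne_zero) |>.1 (le_antisymm h3 (sq_nonneg _))]
      have h5 : n + 2 * t * q + t ^ 2 * r = 0 := by
        rw [h4] at h2
        nlinarith
      have : (n * p - w * q) + t * (p * q - w * r) =
        p * (n + 2 * t * q + t ^ 2 * r) - (w + t * p) * (q + t * r) := by ring
      rw [this, h4, h5] at h1
      simp at h1
  apply strictMonoOn_of_deriv_pos (convex_Icc 0 b)
  · apply ContinuousOn.div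
    · fun_prop
    · fun_prop
    · intro t ht
      exact (Real.sqrt_pos.2 (hN t ht)).ne'
  · intro t ht
    rw [interior_Icc] at ht
    have hNt := hN t ⟨ht.1.le, ht.2.le⟩
    have hsq := Real.sqrt_pos.2 hNt
    have d1 : HasDerivAt (fun t : ℝ => w + t * p) p t := by
      simpa using ((hasDerivAt_id t).mul_const p).const_add w
    have d2 : HasDerivAt (fun t : ℝ => n + 2 * t * q + t ^ 2 * r) (2 * q + 2 * t * r) t := by
      have e1 : HasDerivAt (fun t : ℝ => n + 2 * t * q) (2 * q) t := by
        simpa using ((((hasDerivAt_id t).const_mul 2).mul_const q).const_add n)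
      have e2 : HasDerivAt (fun t : ℝ => t ^ 2 * r) (2 * t * r) t := by
        simpa using (hasDerivAt_pow 2 t).mul_const r
      exact e1.add e2
    have d3 := d1.div (d2.sqrt hNt.ne') hsq.ne'
    have d4 : deriv (fun t : ℝ => (w + t * p) / Real.sqrt (n + 2 * t * q + t ^ 2 * r)) t = _ :=
      d3.deriv
    rw [d4]
    apply div_pos _ (by positivity)
    have h1 := hpos t ht.1.le ht.2
    have hss := Real.sq_sqrt hNt.le
    set S := Real.sqrt (n + 2 * t * q + t ^ 2 * r) with hS
    have : p * S - (w + t * p) * ((2 * q + 2 * t * r) / (2 * S)) =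
        ((n * p - w * q) + t * (p * q - w * r)) / S := by
      field_simp
      rw [hss]; ring
    rw [this]
    positivity

theorem finner_sum {m n : ℕ} (A B : Matrix (Fin m) (Fin n) ℝ) :
    finner A B = ∑ j, ∑ i, A i j * B i j := by
  simp [finner, Matrix.trace, Matrix.mul_apply]

theorem finner_comm {m n : ℕ} (A B : Matrix (Fin m) (Fin n) ℝ) : finner A B = finner B A := by
  simp [finner_sum, mul_comm]

theorem finner_add_left {m n : ℕ} (A B C : Matrix (Fin m) (Fin n) ℝ) :
    finner (A + B) C = finner A C + finner B C := by
  simp [finner, Matrix.add_mul]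

theorem finner_smul_left {m n : ℕ} (c : ℝ) (A B : Matrix (Fin m) (Fin n) ℝ) :
    finner (c • A) B = c * finner A B := by
  simp [finner]

theorem finner_add_right {m n : ℕ} (A B C : Matrix (Fin m) (Fin n) ℝ) :
    finner A (B + C) = finner A B + finner A C := by
  simp [finner, Matrix.mul_add]

theorem finner_smul_right {m n : ℕ} (c : ℝ) (A B : Matrix (Fin m) (Fin n) ℝ) :
    finner A (c • B) = c * finner A B := by
  simp [finner]

theorem finner_self_nonneg {m n : ℕ} (A : Matrix (Fin m) (Fin n) ℝ) : 0 ≤ finner A A := by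
  rw [finner_sum]
  exact Finset.sum_nonneg fun j _ => Finset.sum_nonneg fun i _ => mul_self_nonneg _

theorem entry_sq_le {m n : ℕ} (A : Matrix (Fin m) (Fin n) ℝ) (i : Fin m) (j : Fin n) :
    A i j ^ 2 ≤ finner A A := by
  rw [finner_sum, sq]
  refine le_trans ?_ (Finset.single_le_sum (f := fun j => ∑ i, A i j * A i j)
    (fun j _ => Finset.sum_nonneg fun i _ => mul_self_nonneg _) (Finset.mem_univ j))
  exact Finset.single_le_sum (f := fun i => A i j * A i j)
    (fun i _ => mul_self_nonneg _) (Finset.mem_univ i)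

theorem finner_self_pos {m n : ℕ} (A : Matrix (Fin m) (Fin n) ℝ) (h : A ≠ 0) :
    0 < finner A A := by
  rcases (finner_self_nonneg A).lt_or_eq with h1 | h1
  · exact h1
  · exfalso; apply h; ext i j
    have := entry_sq_le A i j
    rw [← h1] at this
    exact pow_eq_zero_iff two_ne_zero |>.1 (le_antisymm this (sq_nonneg _))

theorem finner_one_one (n : ℕ) : finner (1 : Matrix (Fin n) (Fin n) ℝ) 1 = n := by
  simp [finner]

theorem finner_cs {m n : ℕ} (A B : Matrix (Fin m) (Fin n) ℝ) :
    finner A B ^ 2 ≤ finner B B * finner A A := by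
  have := fun t : ℝ => finner_self_nonneg (A + t • B)
  simp only [finner_add_left, finner_add_right, finner_smul_left, finner_smul_right,
    finner_comm B A] at this
  have h := discrim_le_zero (a := finner B B) (b := 2 * finner A B) (c := finner A A)
    (fun t => by linarith [this t])
  unfold discrim at h
  linarith

theorem fnorm_sq {m n : ℕ} (A : Matrix (Fin m) (Fin n) ℝ) : fnorm A ^ 2 = finner A A :=
  Real.sq_sqrt (finner_self_nonneg A)

theorem finner_mul_pos {n : ℕ} (A : Matrix (Fin n) (Fin n) ℝ) (hA : A.PosDef)
    (D : Matrix (Fin n) (Fin n) ℝ) (hD : D ≠ 0) : 0 < finner (D * A) D := by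
  have e : finner (D * A) D = ∑ i, star (D i) ⬝ᵥ (A *ᵥ (D i)) := by
    rw [finner_comm, finner_sum, Finset.sum_comm]
    refine Finset.sum_congr rfl fun i _ => ?_
    rw [dotProduct_mulVec]
    simp only [star_trivial]
    rw [dotProduct_comm]
    rfl
  rw [e]
  obtain ⟨i, hi⟩ : ∃ i, D i ≠ 0 := by
    by_contra hc
    push Not at hc
    exact hD (funext hc)
  exact Finset.sum_pos' (fun i _ => hA.posSemidef.dotProduct_mulVec_nonneg (D i))
    ⟨i, Finset.mem_univ i, hA.dotProduct_mulVec_pos hi⟩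

theorem continuous_finner {T : Type*} [TopologicalSpace T] {m n : ℕ}
    {f g : T → Matrix (Fin m) (Fin n) ℝ} (hf : Continuous f) (hg : Continuous g) :
    Continuous fun t => finner (f t) (g t) := by
  unfold finner
  exact (hf.matrix_transpose.matrix_mul hg).matrix_trace

noncomputable def mcD {n : ℕ} (Y : Matrix (Fin n) (Fin n) ℝ) : Matrix (Fin n) (Fin n) ℝ :=
  (-(1 / (n : ℝ))) • ((finner Y 1 / (n : ℝ)) • Y - 1)

theorem continuous_mcD {n : ℕ} : Continuous (mcD (n := n)) := by
  unfold mcD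
  have := continuous_finner (T := Matrix (Fin n) (Fin n) ℝ) continuous_id
    (continuous_const (y := (1 : Matrix (Fin n) (Fin n) ℝ)))
  simp only [id] at this
  fun_prop

noncomputable def mcNum {n : ℕ} (A Y : Matrix (Fin n) (Fin n) ℝ) : ℝ :=
  n * finner (mcD Y * A) 1 - finner Y 1 * finner Y (mcD Y * A)

noncomputable def mcDen {n : ℕ} (A Y : Matrix (Fin n) (Fin n) ℝ) : ℝ :=
  finner (mcD Y * A) 1 * finner Y (mcD Y * A) - finner Y 1 * finner (mcD Y * A) (mcD Y * A)

theorem continuous_mcDA {n : ℕ} (A : Matrix (Fin n) (Fin n) ℝ) :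
    Continuous (fun Y => mcD Y * A) := continuous_mcD.matrix_mul continuous_const

theorem continuous_mcNum {n : ℕ} (A : Matrix (Fin n) (Fin n) ℝ) : Continuous (mcNum A) := by
  unfold mcNum
  have h := continuous_mcDA A
  have h1 := continuous_finner h (continuous_const (y := (1 : Matrix (Fin n) (Fin n) ℝ)))
  have h2 := continuous_finner (T := Matrix (Fin n) (Fin n) ℝ) continuous_id
    (continuous_const (y := (1 : Matrix (Fin n) (Fin n) ℝ)))
  have h3 := continuous_finner continuous_id h
  simp only [id] at h2 h3
  fun_prop

theorem continuous_mcDen {n : ℕ} (A : Matrix (Fin n) (Fin n) ℝ) : Continuous (mcDen A) := by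
  unfold mcDen
  have h := continuous_mcDA A
  have h1 := continuous_finner h (continuous_const (y := (1 : Matrix (Fin n) (Fin n) ℝ)))
  have h2 := continuous_finner (T := Matrix (Fin n) (Fin n) ℝ) continuous_id
    (continuous_const (y := (1 : Matrix (Fin n) (Fin n) ℝ)))
  have h3 := continuous_finner continuous_id h
  have h4 := continuous_finner h h
  simp only [id] at h2 h3
  fun_prop

theorem mcNum_eq {n : ℕ} (hn : 1 ≤ n) (A Y : Matrix (Fin n) (Fin n) ℝ) :
    mcNum A Y = n ^ 2 * finner (mcD Y * A) (mcD Y) := by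
  have hn' : (n : ℝ) ≠ 0 := by positivity
  have e : finner (mcD Y * A) (mcD Y) = finner (mcD Y * A)
      ((1 / (n : ℝ)) • (1 : Matrix (Fin n) (Fin n) ℝ) + (-(finner Y 1 / n ^ 2)) • Y) := by
    congr 1
    unfold mcD
    rw [smul_sub, smul_smul, sub_eq_add_neg, add_comm, neg_smul, neg_neg]
    congr 2
    field_simp
  rw [e, finner_add_right, finner_smul_right, finner_smul_right, mcNum, finner_comm Y (mcD Y * A)]
  field_simp
  ring

noncomputable def mcPhi {n : ℕ} (V : Matrix (Fin n) (Fin n) ℝ) : ℝ :=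
  finner V 1 / fnorm V

theorem mcPhi_line {n : ℕ} (Y B : Matrix (Fin n) (Fin n) ℝ) (t : ℝ) (hY : finner Y Y = n) :
    mcPhi (Y + t • B) = (finner Y 1 + t * finner B 1) /
      Real.sqrt (n + 2 * t * finner Y B + t ^ 2 * finner B B) := by
  unfold mcPhi fnorm
  simp only [finner_add_left, finner_add_right, finner_smul_left, finner_smul_right,
    finner_comm B Y, hY]
  congr 2
  ring

theorem mcPhi_mono {n : ℕ} (hn : 1 ≤ n) (A Y : Matrix (Fin n) (Fin n) ℝ)
    (hY : finner Y Y = n) (b : ℝ)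
    (hpos : ∀ t : ℝ, 0 ≤ t → t < b → 0 < mcNum A Y + t * mcDen A Y)
    (hb : Y + b • (mcD Y * A) ≠ 0) :
    StrictMonoOn (fun t : ℝ => mcPhi (Y + t • (mcD Y * A))) (Set.Icc 0 b) := by
  have hN : ∀ t : ℝ, finner (Y + t • (mcD Y * A)) (Y + t • (mcD Y * A)) =
      n + 2 * t * finner Y (mcD Y * A) + t ^ 2 * finner (mcD Y * A) (mcD Y * A) := by
    intro t
    simp only [finner_add_left, finner_add_right, finner_smul_left, finner_smul_right,
      finner_comm (mcD Y * A) Y, hY]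
    ring
  simp only [mcPhi_line Y _ _ hY]
  apply mc_mono
  · exact_mod_cast hn
  · intro t
    have := finner_cs (Y + t • (mcD Y * A)) 1
    rw [finner_one_one, hN, finner_add_left, finner_smul_left] at this
    exact this
  · exact hpos
  · rw [← hN]; exact finner_self_pos _ hb

theorem mc_ne_zero {n : ℕ} (A Y : Matrix (Fin n) (Fin n) ℝ)
    (hY : finner Y Y = n) (t : ℝ) (h : 0 < mcNum A Y + t * mcDen A Y) :
    Y + t • (mcD Y * A) ≠ 0 := by
  intro h0
  have h1 : Y = (-t) • (mcD Y * A) := by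
    rw [neg_smul]; exact eq_neg_of_add_eq_zero_left h0
  unfold mcNum mcDen at h
  rw [← hY] at h
  generalize mcD Y * A = B at *
  subst h1
  simp only [finner_smul_left, finner_smul_right] at h
  ring_nf at h
  exact lt_irrefl _ h

theorem mc_seq {n : ℕ} (hn : 1 ≤ n) (A : Matrix (Fin n) (Fin n) ℝ) (hA : A.PosDef)
    (Y : ℕ → Matrix (Fin n) (Fin n) ℝ) (al : ℕ → ℝ)
    (hY : ∀ k, finner (Y k) (Y k) = n)
    (hW : ∀ k, 0 ≤ finner (Y k) 1)
    (hden : ∀ k, mcDen A (Y k) ≠ 0)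
    (hal : ∀ k, al k = |mcNum A (Y k) / mcDen A (Y k)|)
    (hne : ∀ k, Y k + al k • (mcD (Y k) * A) ≠ 0)
    (hstep : ∀ k, Real.sqrt n * mcPhi (Y k + al k • (mcD (Y k) * A)) ≤ finner (Y (k+1)) 1) :
    Tendsto Y atTop (nhds 1) := by
  have hn0 : (0 : ℝ) < n := by exact_mod_cast hn
  have hsn : 0 < Real.sqrt n := Real.sqrt_pos.2 hn0
  have hnum : ∀ V, mcD V ≠ 0 → 0 < mcNum A V := by
    intro V hV
    rw [mcNum_eq hn]
    have := finner_mul_pos A hA _ hV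
    positivity
  have hD : ∀ k, mcD (Y k) ≠ 0 := by
    intro k h
    apply hden k
    simp [mcDen, h, finner]
  have hmono : ∀ k, StrictMonoOn (fun t : ℝ => mcPhi (Y k + t • (mcD (Y k) * A)))
      (Set.Icc 0 (al k)) := by
    intro k
    apply mcPhi_mono hn A _ (hY k) _ _ (hne k)
    intro t h0 ht
    have h1 := hnum _ (hD k)
    rw [hal, abs_div, abs_of_pos h1, lt_div_iff₀ (abs_pos.2 (hden k))] at ht
    have := mul_le_mul_of_nonneg_left (neg_abs_le (mcDen A (Y k))) h0
    linarith
  have hPhi0 : ∀ V : Matrix (Fin n) (Fin n) ℝ, finner V V = n →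
      Real.sqrt n * mcPhi V = finner V 1 := by
    intro V hV
    unfold mcPhi fnorm
    rw [hV]; field_simp
  have halpos : ∀ k, 0 ≤ al k := fun k => by rw [hal]; positivity
  have hstep2 : ∀ k a, 0 ≤ a → a ≤ al k →
      Real.sqrt n * mcPhi (Y k + a • (mcD (Y k) * A)) ≤ finner (Y (k+1)) 1 := by
    intro k a h0 ha
    refine le_trans ?_ (hstep k)
    exact mul_le_mul_of_nonneg_left
      ((hmono k).monotoneOn ⟨h0, ha⟩ ⟨halpos k, le_rfl⟩ ha) hsn.le
  have hWmono : Monotone fun k => finner (Y k) 1 := by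
    apply monotone_nat_of_le_succ
    intro k
    have := hstep2 k 0 le_rfl (halpos k)
    rw [zero_smul, add_zero, hPhi0 _ (hY k)] at this
    exact this
  have hWle : ∀ k, finner (Y k) 1 ≤ n := by
    intro k
    have := finner_cs (Y k) 1
    rw [finner_one_one, hY] at this
    nlinarith [hW k]
  have hWlim : ∃ L, Tendsto (fun k => finner (Y k) 1) atTop (nhds L) :=
    ⟨_, tendsto_atTop_ciSup hWmono ⟨n, by rintro _ ⟨k, rfl⟩; exact hWle k⟩⟩
  obtain ⟨L, hL⟩ := hWlim
  have hcomp : IsCompact (Set.univ.pi fun _ : Fin n => Set.univ.pi fun _ : Fin n =>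
      Set.Icc (-Real.sqrt n) (Real.sqrt n)) :=
    isCompact_univ_pi fun _ => isCompact_univ_pi fun _ => isCompact_Icc
  have hsub := IsCompact.tendsto_subseq (X := Fin n → Fin n → ℝ) hcomp
    (x := fun k i j => Y k i j) (by
      intro k i _ j _
      have := entry_sq_le (Y k) i j
      rw [hY] at this
      exact abs_le.1 (Real.abs_le_sqrt this))
  obtain ⟨V', -, φ, hφ, hV'⟩ := hsub
  obtain ⟨V, hV⟩ : ∃ V : Matrix (Fin n) (Fin n) ℝ, Tendsto (Y ∘ φ) atTop (nhds V) :=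
    ⟨V', hV'⟩
  have hWc : Continuous fun V : Matrix (Fin n) (Fin n) ℝ => finner V 1 :=
    continuous_finner continuous_id continuous_const
  have hVc : Continuous fun V : Matrix (Fin n) (Fin n) ℝ => finner V V :=
    continuous_finner continuous_id continuous_id
  have hVV : finner V V = n := by
    refine tendsto_nhds_unique ((hVc.tendsto V).comp hV) ?_
    have : ((fun V => finner V V) ∘ Y ∘ φ) = fun _ => (n : ℝ) := by
      funext k; exact hY _
    rw [this]; exact tendsto_const_nhds
  have hVL : finner V 1 = L :=
    tendsto_nhds_unique ((hWc.tendsto V).comp hV) (hL.comp hφ.tendsto_atTop)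
  have hDV : mcD V = 0 := by
    by_contra hDV
    have hnV := hnum V hDV
    set a := mcNum A V / (2 * (|mcDen A V| + 1)) with ha
    have hc0 := abs_nonneg (mcDen A V)
    have ha0 : 0 < a := by positivity
    have hale : ∀ t, 0 ≤ t → t ≤ a → 0 < mcNum A V + t * mcDen A V := by
      intro t h0 ht
      rw [ha, le_div_iff₀ (by positivity)] at ht
      have := mul_le_mul_of_nonneg_left (neg_abs_le (mcDen A V)) h0
      nlinarith
    have hne' := mc_ne_zero A V hVV a (hale a ha0.le le_rfl)
    have hlt := mcPhi_mono hn A V hVV a (fun t h0 ht => hale t h0 ht.le) hne'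
      ⟨le_rfl, ha0.le⟩ ⟨ha0.le, le_rfl⟩ ha0
    simp only [zero_smul, add_zero] at hlt
    have hlt2 := mul_lt_mul_of_pos_left hlt hsn
    rw [hPhi0 V hVV, hVL] at hlt2
    have hev : ∀ᶠ k in atTop, a ≤ al (φ k) := by
      have e1 := ((continuous_mcNum A).tendsto V).comp hV
      have e2 := (((continuous_mcDen A).tendsto V).comp hV).abs
      have e3 := e1.sub (e2.const_mul a)
      have h3 : 0 < mcNum A V - a * |mcDen A V| := by
        have : a * (2 * (|mcDen A V| + 1)) = mcNum A V := by
          rw [ha]; field_simp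
        nlinarith
      filter_upwards [e3.eventually (lt_mem_nhds h3)] with k hk
      simp only [Function.comp] at hk
      rw [hal, abs_div, le_div_iff₀ (abs_pos.2 (hden _))]
      have := le_abs_self (mcNum A (Y (φ k)))
      linarith
    have hlim : Tendsto (fun k => Real.sqrt n * mcPhi (Y (φ k) + a • (mcD (Y (φ k)) * A))) atTop
        (nhds (Real.sqrt n * mcPhi (V + a • (mcD V * A)))) := by
      apply Tendsto.const_mul
      have hc : Continuous fun V => V + a • (mcD V * A) :=
        continuous_id.add ((continuous_mcDA A).const_smul a)
      have c1 := ((hWc.comp hc).tendsto V).comp hV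
      have c2 := ((Real.continuous_sqrt.comp (hVc.comp hc)).tendsto V).comp hV
      exact c1.div c2 (Real.sqrt_pos.2 (finner_self_pos _ hne')).ne'
    have hle := le_of_tendsto_of_tendsto hlim
      ((hL.comp (tendsto_add_atTop_nat 1)).comp hφ.tendsto_atTop)
      (hev.mono fun k hk => hstep2 (φ k) a ha0.le hk)
    exact absurd hle (not_le.2 hlt2)
  have hLn : L = n := by
    have h1 : finner (mcD V) 1 = 0 := by rw [hDV]; simp [finner]
    have h2 : finner (mcD V) 1 = -(1 / (n : ℝ)) * (finner V 1 / n * finner V 1 - n) := by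
      unfold mcD
      rw [finner_smul_left, sub_eq_add_neg, finner_add_left, finner_smul_left,
        ← neg_one_smul ℝ (1 : Matrix (Fin n) (Fin n) ℝ), finner_smul_left, finner_one_one]
      ring
    rw [h2, hVL] at h1
    have hL0 : 0 ≤ L := ge_of_tendsto' hL hW
    have h3 : L ^ 2 = (n : ℝ) ^ 2 := by
      field_simp at h1
      nlinarith
    exact (pow_left_inj₀ hL0 hn0.le two_ne_zero).1 h3
  have hdist : ∀ k, finner (Y k - 1) (Y k - 1) = 2 * n - 2 * finner (Y k) 1 := by
    intro k
    rw [sub_eq_add_neg, ← neg_one_smul ℝ (1 : Matrix (Fin n) (Fin n) ℝ)]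
    simp only [finner_add_left, finner_add_right, finner_smul_left, finner_smul_right,
      finner_comm 1 (Y k), hY, finner_one_one]
    ring
  have hz : Tendsto (fun k => Real.sqrt (2 * n - 2 * finner (Y k) 1)) atTop (nhds 0) := by
    have h1 : Tendsto (fun k => 2 * (n : ℝ) - 2 * finner (Y k) 1) atTop (nhds 0) := by
      have := (hL.const_mul 2).const_sub (2 * (n : ℝ))
      rw [hLn] at this
      simpa using this
    have := (Real.continuous_sqrt.tendsto 0).comp h1
    rw [Real.sqrt_zero] at this
    exact this
  refine tendsto_pi_nhds.2 fun i => tendsto_pi_nhds.2 fun j => ?_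
  rw [tendsto_iff_dist_tendsto_zero]
  refine squeeze_zero (fun _ => dist_nonneg) (fun k => ?_) hz
  rw [Real.dist_eq]
  apply Real.abs_le_sqrt
  rw [← hdist]
  exact entry_sq_le (Y k - 1) i j

/-- Convergence of the MinCos iteration: for `A` real symmetric positive definite
(`n ≥ 1`) and the sequence `X(k)` generated by Algorithm 1 (MinCos) from an initial
symmetric positive semidefinite `X(0)` commuting with `A` and with
`trace (X(0)·A) > 0`, the sequence `X(k)` converges to `A⁻¹`. -/
theorem mincos_converges (n : ℕ) (hn : 1 ≤ n)
    (A : Matrix (Fin n) (Fin n) ℝ) (hA : A.PosDef)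
    (X Z D : ℕ → Matrix (Fin n) (Fin n) ℝ) (w αs s : ℕ → ℝ)
    (hX0 : (X 0).PosSemidef)
    (hcomm : X 0 * A = A * X 0)
    (htr0 : 0 < (X 0 * A).trace)
    (hw : ∀ k, w k = finner (X k * A) (1 : Matrix (Fin n) (Fin n) ℝ))
    (hD : ∀ k, D k = (-(1 / (n : ℝ))) • ((w k / (n : ℝ)) • (X k * A) - 1))
    (hden : ∀ k, finner (D k * A) (1 : Matrix (Fin n) (Fin n) ℝ) *
        finner (X k * A) (D k * A) - w k * fnorm (D k * A) ^ 2 ≠ 0)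
    (hαs : ∀ k, αs k =
      |((n : ℝ) * finner (D k * A) (1 : Matrix (Fin n) (Fin n) ℝ) -
          w k * finner (X k * A) (D k * A)) /
        (finner (D k * A) (1 : Matrix (Fin n) (Fin n) ℝ) *
          finner (X k * A) (D k * A) - w k * fnorm (D k * A) ^ 2)|)
    (hZ : ∀ k, Z (k + 1) = X k + αs k • D k)
    (hZA : ∀ k, Z (k + 1) * A ≠ 0)
    (hs : ∀ k, s k = if 0 < (Z (k + 1) * A).trace then (1 : ℝ) else -1)
    (hXnext : ∀ k, X (k + 1) = (s k * Real.sqrt n / fnorm (Z (k + 1) * A)) • Z (k + 1)) :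
    Filter.Tendsto X Filter.atTop (nhds A⁻¹) := by
  have hn0 : (0 : ℝ) < n := by exact_mod_cast hn
  have hDk : ∀ k, D k = mcD (X k * A) := by
    intro k; rw [hD, hw]; rfl
  have hZAk : ∀ k, Z (k + 1) * A = X k * A + αs k • (mcD (X k * A) * A) := by
    intro k; rw [hZ, hDk, Matrix.add_mul, Matrix.smul_mul]
  have htrace : ∀ V : Matrix (Fin n) (Fin n) ℝ, finner V 1 = V.trace := by
    intro V; simp [finner]
  have hXA : ∀ k, X (k + 1) * A =
      (s k * Real.sqrt n / fnorm (Z (k + 1) * A)) • (Z (k + 1) * A) := by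
    intro k; rw [hXnext, Matrix.smul_mul]
  have hfp : ∀ k, 0 < fnorm (Z (k + 1) * A) := fun k =>
    Real.sqrt_pos.2 (finner_self_pos _ (hZA k))
  have hW : ∀ k, finner (X (k + 1) * A) 1 =
      Real.sqrt n * |finner (Z (k + 1) * A) 1| / fnorm (Z (k + 1) * A) := by
    intro k
    rw [hXA, finner_smul_left, hs, htrace]
    split_ifs with h
    · rw [abs_of_pos h]; ring
    · rw [abs_of_nonpos (not_lt.1 h)]; ring
  have hmain : Tendsto (fun k => X (k + 1) * A) atTop (nhds 1) := by
    apply mc_seq hn A hA _ (fun k => αs (k + 1))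
    · intro k
      rw [hXA, finner_smul_left, finner_smul_right, ← fnorm_sq]
      have hs2 : s k ^ 2 = 1 := by rw [hs]; split_ifs <;> norm_num
      have h1 := Real.sq_sqrt hn0.le
      have h2 := (hfp k).ne'
      field_simp
      rw [hs2, h1, one_mul]
    · intro k
      rw [hW]
      have := hfp k
      positivity
    · intro k
      have := hden (k + 1)
      rw [fnorm_sq, hDk, hw] at this
      exact this
    · intro k
      have := hαs (k + 1)
      rw [fnorm_sq, hDk, hw] at this
      exact this
    · intro k
      rw [← hZAk]; exact hZA _
    · intro k
      rw [← hZAk, hW, mcPhi, mul_div_assoc]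
      have := hfp (k + 1)
      gcongr
      exact le_abs_self _
  rw [← tendsto_add_atTop_iff_nat 1]
  have hdet : IsUnit A.det := hA.det_pos.ne'.isUnit
  have hc : Continuous fun V : Matrix (Fin n) (Fin n) ℝ => V * A⁻¹ :=
    continuous_id.matrix_mul continuous_const
  have := (hc.tendsto 1).comp hmain
  rw [one_mul] at this
  refine this.congr fun k => ?_
  simp [Matrix.mul_assoc, Matrix.mul_nonsing_inv _ hdet]
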